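/- Let G=(V,E) be a 2-vertex-twinless connected directed graph with n = |V| vertices (and no self-loops). Let E_{2v} ⊆ E be such that (V,E_{2v}) is 2-vertex-connected and |E_{2v}| ≤ 4n, and let a_t be the number of twinless articulation points of (V,E_{2v}). Then there exists E_{2t} ⊆ E such that (V,E_{2t}) is 2-vertex-twinless connected and, for every E_opt ⊆ E of minimum cardinality with (V,E_opt) 2-vertex-twinless connected, |E_{2t}| ≤ (2 + a_t/2)·|E_opt|. -/

import Mathlib

/-- `F` contains no pair of antiparallel edges. -/
def NoAntiparallel {V : Type*} (F : Finset (V × V)) : Prop :=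
  ∀ a b : V, (a, b) ∈ F → (b, a) ∉ F

/-- There is a directed path from `u` to `v` using edges of `F` that stay inside `S`. -/
def PathOn {V : Type*} (F : Finset (V × V)) (S : Set V) (u v : V) : Prop :=
  Relation.ReflTransGen (fun a b => a ∈ S ∧ b ∈ S ∧ (a, b) ∈ F) u v

/-- The subgraph of `(V, E)` induced on `S` is strongly connected. -/
def StronglyConnectedOn {V : Type*} (E : Finset (V × V)) (S : Set V) : Prop :=
  ∀ u ∈ S, ∀ v ∈ S, PathOn E S u v

/-- The subgraph of `(V, E)` induced on `S` is twinless strongly connected. -/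
def TwinlessSConnOn {V : Type*} (E : Finset (V × V)) (S : Set V) : Prop :=
  ∃ E' ⊆ E, NoAntiparallel E' ∧ StronglyConnectedOn E' S

/-- `(V, E)` is 2-vertex-connected. -/
def TwoVertexConnected (V : Type*) [Fintype V] (E : Finset (V × V)) : Prop :=
  3 ≤ Fintype.card V ∧ ∀ U : Finset V, U.card ≤ 1 → StronglyConnectedOn E (↑U)ᶜ

/-- `(V, E)` is 2-vertex-twinless connected. -/
def TwoVertexTwinlessConnected (V : Type*) [Fintype V] (E : Finset (V × V)) : Prop :=
  3 ≤ Fintype.card V ∧ ∀ U : Finset V, U.card ≤ 1 → TwinlessSConnOn E (↑U)ᶜ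

/-- `u` and `v` are twinless strongly connected in the subgraph of `(V, E)` induced on `S`. -/
def TwinlessRelOn {V : Type*} (E : Finset (V × V)) (S : Set V) (u v : V) : Prop :=
  ∃ F ⊆ E, NoAntiparallel F ∧ PathOn F S u v ∧ PathOn F S v u

/-- `u` and `v` are twinless strongly connected in `(V, E)`. -/
def TwinlessRel {V : Type*} (E : Finset (V × V)) (u v : V) : Prop :=
  TwinlessRelOn E Set.univ u v

/-- `C` is a twinless strongly connected component of `(V, E)`. -/
def IsTSCC {V : Type*} (E : Finset (V × V)) (C : Set V) : Prop :=
  ∃ v : V, C = {u | TwinlessRel E v u}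

/-- The number of twinless strongly connected components of `(V, E)`. -/
noncomputable def numTSCC (V : Type*) (E : Finset (V × V)) : ℕ :=
  Set.ncard {C : Set V | IsTSCC E C}

section Connectivity

variable {V : Type*} {E F H : Finset (V × V)} {S X X' : Set V} {a a' b r u v : V}

theorem PathOn.mono (h : PathOn E S u v) (hEF : E ⊆ F) : PathOn F S u v :=
  Relation.ReflTransGen.mono (fun _ _ ⟨hc, hd, he⟩ => ⟨hc, hd, hEF he⟩) _ _ h

theorem StronglyConnectedOn.mono (h : StronglyConnectedOn E S) (hEF : E ⊆ F) :
    StronglyConnectedOn F S :=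
  fun u hu v hv => (h u hu v hv).mono hEF

theorem TwinlessSConnOn.mono (h : TwinlessSConnOn E S) (hEF : E ⊆ F) : TwinlessSConnOn F S :=
  let ⟨E', hE', hanti, hconn⟩ := h
  ⟨E', hE'.trans hEF, hanti, hconn⟩

theorem TwinlessSConnOn.stronglyConnectedOn (h : TwinlessSConnOn E S) :
    StronglyConnectedOn E S :=
  let ⟨_, hE', _, hconn⟩ := h
  hconn.mono hE'

/-- A path that starts in `X` and ends outside `X` uses an edge leaving `X`. -/
theorem PathOn.exists_leaving (h : PathOn E S u v) (hu : u ∈ X) (hv : v ∉ X) :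
    ∃ c ∈ S, ∃ d ∈ S, (c, d) ∈ E ∧ c ∈ X ∧ d ∉ X := by
  induction h with
  | refl => exact absurd hu hv
  | @tail c d _ hcd ih =>
    by_cases hc : c ∈ X
    · exact ⟨c, hcd.1, d, hcd.2.1, hcd.2.2, hc, hv⟩
    · exact ih hc

theorem StronglyConnectedOn.exists_leaving (h : StronglyConnectedOn E S) (huS : u ∈ S)
    (hvS : v ∈ S) (hu : u ∈ X) (hv : v ∉ X) :
    ∃ c ∈ S, ∃ d ∈ S, (c, d) ∈ E ∧ c ∈ X ∧ d ∉ X :=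
  (h u huS v hvS).exists_leaving hu hv

/-- The edge `ab` is a bridge of the undirected graph underlying the subgraph of `(V, E)` induced
on `S`, in the sense that no other edge crosses the cut `(X, S \ X)`. -/
structure IsBridgeCut (E : Finset (V × V)) (S : Set V) (a b : V) (X : Set V) : Prop where
  left_mem : a ∈ S
  right_mem : b ∈ S
  subset : X ⊆ S
  left_mem_cut : a ∈ X
  right_notMem_cut : b ∉ X
  eq_of_leaving : ∀ c ∈ S, ∀ d ∈ S, (c, d) ∈ E → c ∈ X → d ∉ X → c = a ∧ d = b
  eq_of_entering : ∀ c ∈ S, ∀ d ∈ S, (c, d) ∈ E → c ∉ X → d ∈ X → c = b ∧ d = a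

/-- The undirected graph underlying the subgraph of `(V, E)` induced on `S` has no bridge. -/
def BridgelessOn (E : Finset (V × V)) (S : Set V) : Prop :=
  ∀ a b X, ¬ IsBridgeCut E S a b X

theorem IsBridgeCut.anti (h : IsBridgeCut F S a b X) (hEF : E ⊆ F) : IsBridgeCut E S a b X where
  __ := h
  eq_of_leaving c hc d hd he := h.eq_of_leaving c hc d hd (hEF he)
  eq_of_entering c hc d hd he := h.eq_of_entering c hc d hd (hEF he)

theorem IsBridgeCut.symm (h : IsBridgeCut E S a b X) : IsBridgeCut E S b a (S \ X) where
  left_mem := h.right_mem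
  right_mem := h.left_mem
  subset := Set.sdiff_subset
  left_mem_cut := ⟨h.right_mem, h.right_notMem_cut⟩
  right_notMem_cut ha := ha.2 h.left_mem_cut
  eq_of_leaving c hc d hd he hcX hdX :=
    h.eq_of_entering c hc d hd he hcX.2 (by_contra fun hd' => hdX ⟨hd, hd'⟩)
  eq_of_entering c hc d hd he hcX hdX :=
    h.eq_of_leaving c hc d hd he (by_contra fun hc' => hcX ⟨hc, hc'⟩) hdX.2

theorem IsBridgeCut.edge_mem (h : IsBridgeCut E S a b X) (hE : StronglyConnectedOn E S) :
    (a, b) ∈ E := by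
  obtain ⟨c, hc, d, hd, he, hcX, hdX⟩ :=
    hE.exists_leaving h.left_mem h.right_mem h.left_mem_cut h.right_notMem_cut
  obtain ⟨rfl, rfl⟩ := h.eq_of_leaving c hc d hd he hcX hdX
  exact he

/-- A bridge of a strongly connected graph is determined by its endpoint on the side away from a
given vertex `r`. -/
theorem IsBridgeCut.left_unique (h : IsBridgeCut E S a b X) (h' : IsBridgeCut E S a' b X')
    (hE : StronglyConnectedOn E S) (hr : r ∈ X) (hr' : r ∈ X') : a = a' := by
  by_contra hne
  have ha : a ∉ X' := fun ha =>
    hne (h'.eq_of_leaving a h.left_mem b h.right_mem (h.edge_mem hE) ha h'.right_notMem_cut).1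
  have ha' : a' ∉ X := fun ha' =>
    hne (h.eq_of_leaving a' h'.left_mem b h.right_mem (h'.edge_mem hE) ha' h.right_notMem_cut).1.symm
  obtain ⟨c, hc, d, hd, he, hcX, hdX⟩ := hE.exists_leaving (X := X ∩ X') (h.subset hr) h.right_mem
    ⟨hr, hr'⟩ fun hb => h.right_notMem_cut hb.1
  by_cases hdX' : d ∈ X
  · obtain ⟨rfl, -⟩ := h'.eq_of_leaving c hc d hd he hcX.2 fun hd' => hdX ⟨hdX', hd'⟩
    exact ha' hcX.1
  · obtain ⟨rfl, -⟩ := h.eq_of_leaving c hc d hd he hcX.1 hdX'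
    exact ha hcX.2

theorem IsBridgeCut.cut_subset (h : IsBridgeCut E S a b X) (h' : IsBridgeCut E S a b X')
    (hE : StronglyConnectedOn E S) : X ⊆ X' := by
  intro x hx
  by_contra hx'
  obtain ⟨c, hc, d, hd, he, hcX, hdX⟩ := hE.exists_leaving (X := X \ X') (h.subset hx) h.left_mem
    ⟨hx, hx'⟩ fun ha => ha.2 h'.left_mem_cut
  by_cases hdX' : d ∈ X
  · obtain ⟨rfl, -⟩ := h'.eq_of_entering c hc d hd he hcX.2 (by_contra fun hd' => hdX ⟨hdX', hd'⟩)
    exact h.right_notMem_cut hcX.1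
  · obtain ⟨rfl, -⟩ := h.eq_of_leaving c hc d hd he hcX.1 hdX'
    exact hcX.2 h'.left_mem_cut

theorem BridgelessOn.mono (h : BridgelessOn E S) (hEF : E ⊆ F) : BridgelessOn F S :=
  fun a b X hX => h a b X (hX.anti hEF)

theorem TwinlessSConnOn.bridgelessOn (h : TwinlessSConnOn E S) : BridgelessOn E S := by
  obtain ⟨E', hE', hanti, hconn⟩ := h
  refine BridgelessOn.mono (fun a b X hX => ?_) hE'
  exact hanti a b (hX.edge_mem hconn) (hX.symm.edge_mem hconn)

theorem BridgelessOn.erase [DecidableEq V] (h : BridgelessOn E S) (hab : a ≠ b)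
    (hba : (b, a) ∈ E) : BridgelessOn (E.erase (a, b)) S := by
  intro p q X hX
  have hba' : (b, a) ∈ E.erase (a, b) := by simp [hba, hab]
  refine h p q X ⟨hX.1, hX.2, hX.3, hX.4, hX.5, fun c hc d hd he hcX hdX => ?_,
    fun c hc d hd he hcX hdX => ?_⟩
  · by_cases hcd : (c, d) = (a, b)
    · obtain ⟨rfl, rfl⟩ := Prod.mk.inj hcd
      exact (hX.eq_of_entering d hd c hc hba' hdX hcX).symm
    · exact hX.eq_of_leaving c hc d hd (Finset.mem_erase.2 ⟨hcd, he⟩) hcX hdX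
  · by_cases hcd : (c, d) = (a, b)
    · obtain ⟨rfl, rfl⟩ := Prod.mk.inj hcd
      exact (hX.eq_of_leaving d hd c hc hba' hdX hcX).symm
    · exact hX.eq_of_entering c hc d hd (Finset.mem_erase.2 ⟨hcd, he⟩) hcX hdX

/-- If erasing the edge `(a, b)` destroys strong connectivity, then it is the only edge leaving
some set. -/
theorem StronglyConnectedOn.exists_cut_of_not_erase [DecidableEq V] (h : StronglyConnectedOn E S)
    (hE : ¬ StronglyConnectedOn (E.erase (a, b)) S) :
    a ∈ S ∧ b ∈ S ∧ ∃ X ⊆ S, a ∈ X ∧ b ∉ X ∧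
      ∀ c ∈ S, ∀ d ∈ S, (c, d) ∈ E → c ∈ X → d ∉ X → c = a ∧ d = b := by
  have key : a ∈ S ∧ b ∈ S ∧ ¬ PathOn (E.erase (a, b)) S a b := by
    by_contra hcon
    refine hE fun u hu v hv => ?_
    refine Relation.reflTransGen_closed (fun c d ⟨hc, hd, he⟩ => ?_) _ _ (h u hu v hv)
    by_cases hcd : (c, d) = (a, b)
    · obtain ⟨rfl, rfl⟩ := Prod.mk.inj hcd
      exact by_contra fun hp => hcon ⟨hc, hd, hp⟩
    · exact .single ⟨hc, hd, Finset.mem_erase.2 ⟨hcd, he⟩⟩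
  refine ⟨key.1, key.2.1, {v | v ∈ S ∧ PathOn (E.erase (a, b)) S a v}, fun _ hx => hx.1,
    ⟨key.1, .refl⟩, fun hb => key.2.2 hb.2, fun c hc d hd he hcX hdX => ?_⟩
  by_contra hne
  exact hdX ⟨hd, hcX.2.tail ⟨hc, hd, Finset.mem_erase.2 ⟨fun hcd => hne (Prod.mk.inj hcd), he⟩⟩⟩

/-- In a strongly connected graph without bridges, one of two antiparallel edges may be erased. -/
theorem StronglyConnectedOn.erase_or_erase [DecidableEq V] (h : StronglyConnectedOn E S)
    (hb : BridgelessOn E S) (a b : V) :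
    StronglyConnectedOn (E.erase (a, b)) S ∨ StronglyConnectedOn (E.erase (b, a)) S := by
  by_contra! hcon
  obtain ⟨haS, hbS, X, hXS, haX, hbX, hX⟩ := h.exists_cut_of_not_erase hcon.1
  obtain ⟨-, -, Y, hYS, hbY, haY, hY⟩ := h.exists_cut_of_not_erase hcon.2
  have hdisj : ∀ x ∈ X, x ∉ Y := by
    intro x hx hxY
    obtain ⟨c, hc, d, hd, he, hcXY, hdXY⟩ := h.exists_leaving (X := X ∩ Y) (hXS hx) haS ⟨hx, hxY⟩
      fun ha => haY ha.2
    by_cases hdX : d ∈ X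
    · obtain ⟨rfl, -⟩ := hY c hc d hd he hcXY.2 fun hd' => hdXY ⟨hdX, hd'⟩
      exact hbX hcXY.1
    · obtain ⟨rfl, -⟩ := hX c hc d hd he hcXY.1 hdX
      exact haY hcXY.2
  have hcover : ∀ x ∈ S, x ∉ X → x ∈ Y := by
    intro x hx hxX
    by_contra hxY
    obtain ⟨c, hc, d, hd, he, hcXY, hdXY⟩ := h.exists_leaving (X := X ∪ Y) haS hx (.inl haX)
      (by simp [hxX, hxY])
    rcases hcXY with hcX | hcY
    · obtain ⟨-, rfl⟩ := hX c hc d hd he hcX fun hd' => hdXY (.inl hd')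
      exact hdXY (.inr hbY)
    · obtain ⟨-, rfl⟩ := hY c hc d hd he hcY fun hd' => hdXY (.inr hd')
      exact hdXY (.inl haX)
  exact hb a b X ⟨haS, hbS, hXS, haX, hbX, hX, fun c hc d hd he hcX hdX =>
    hY c hc d hd he (hcover c hc hcX) (hdisj d hdX)⟩

/-- A strongly connected graph whose underlying undirected graph has no bridge is twinless strongly
connected. -/
theorem StronglyConnectedOn.twinlessSConnOn (h : StronglyConnectedOn E S) (hb : BridgelessOn E S)
    (hloop : ∀ u, (u, u) ∉ E) : TwinlessSConnOn E S := by
  classical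
  induction E using Finset.strongInduction with
  | H E ih =>
    by_cases hanti : NoAntiparallel E
    · exact ⟨E, subset_rfl, hanti, h⟩
    have erase_step : ∀ a b, (a, b) ∈ E → (b, a) ∈ E → StronglyConnectedOn (E.erase (a, b)) S →
        TwinlessSConnOn E S := fun a b hab hba hE =>
      have hne : a ≠ b := by rintro rfl; exact hloop _ hab
      (ih _ (Finset.erase_ssubset hab) hE (hb.erase hne hba)
        fun u hu => hloop u (Finset.mem_of_mem_erase hu)).mono (Finset.erase_subset _ _)
    simp only [NoAntiparallel, not_forall, not_not] at hanti
    obtain ⟨a, b, hab, hba⟩ := hanti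
    rcases h.erase_or_erase hb a b with hE | hE
    · exact erase_step a b hab hba hE
    · exact erase_step b a hba hab hE

/-- A strongly connected spanning subgraph of a bridgeless graph becomes bridgeless after adding at
most one edge per vertex. -/
theorem StronglyConnectedOn.exists_bridgelessOn_union [Fintype V] [DecidableEq V]
    (h : StronglyConnectedOn H S) (hE : BridgelessOn E S) :
    ∃ A ⊆ E, A.card ≤ Fintype.card V ∧ BridgelessOn (H ∪ A) S := by
  rcases S.eq_empty_or_nonempty with rfl | ⟨r, hr⟩
  · exact ⟨∅, by simp, by simp, fun a b X hX => hX.left_mem⟩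
  have hcross : ∀ b, ∃ A ⊆ E, A.card ≤ 1 ∧
      ∀ a X, r ∈ X → IsBridgeCut H S a b X → ¬ IsBridgeCut A S a b X := by
    intro b
    by_cases hex : ∃ a X, r ∈ X ∧ IsBridgeCut H S a b X
    · obtain ⟨a, X, hrX, hX⟩ := hex
      obtain ⟨e, he, hA⟩ : ∃ e ∈ E, ¬ IsBridgeCut {e} S a b X := by
        by_contra! hcon
        exact hE a b X ⟨hX.1, hX.2, hX.3, hX.4, hX.5,
          fun c hc d hd he => (hcon _ he).eq_of_leaving c hc d hd (by simp),
          fun c hc d hd he => (hcon _ he).eq_of_entering c hc d hd (by simp)⟩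
      refine ⟨{e}, by simpa using he, by simp, fun a' X' hrX' hX' => ?_⟩
      obtain rfl := hX.left_unique hX' h hrX hrX'
      rwa [(hX'.cut_subset hX h).antisymm (hX.cut_subset hX' h)]
    · exact ⟨∅, by simp, by simp, fun a X hrX hX => absurd ⟨a, X, hrX, hX⟩ hex⟩
  choose A hAE hAcard hA using hcross
  refine ⟨Finset.univ.biUnion A, Finset.biUnion_subset.2 fun b _ => hAE b, ?_, ?_⟩
  · simpa using Finset.card_biUnion_le_card_mul Finset.univ A 1 fun b _ => hAcard b
  · have no_cut : ∀ a b X, r ∈ X → ¬ IsBridgeCut (H ∪ Finset.univ.biUnion A) S a b X :=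
      fun a b X hrX hX => hA b a X hrX (hX.anti Finset.subset_union_left)
        (hX.anti ((Finset.subset_biUnion_of_mem A (Finset.mem_univ b)).trans
          Finset.subset_union_right))
    intro a b X hX
    by_cases hrX : r ∈ X
    · exact no_cut a b X hrX hX
    · exact no_cut b a (S \ X) ⟨hr, hrX⟩ hX.symm

end Connectivity

section TwoVertexConnected

variable {V : Type*} [Fintype V] {E : Finset (V × V)}

theorem TwoVertexTwinlessConnected.twoVertexConnected (h : TwoVertexTwinlessConnected V E) :
    TwoVertexConnected V E :=
  ⟨h.1, fun U hU => (h.2 U hU).stronglyConnectedOn⟩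

theorem TwoVertexConnected.stronglyConnectedOn_univ (h : TwoVertexConnected V E) :
    StronglyConnectedOn E Set.univ := by
  simpa using h.2 ∅ (by simp)

theorem TwoVertexConnected.stronglyConnectedOn_compl (h : TwoVertexConnected V E) (x : V) :
    StronglyConnectedOn E {x}ᶜ := by
  simpa using h.2 {x} (by simp)

theorem exists_ne_ne_of_three_le_card (h : 3 ≤ Fintype.card V) (a b : V) : ∃ c, c ≠ a ∧ c ≠ b := by
  classical
  obtain ⟨c, hc⟩ := Finset.exists_mem_notMem_of_card_lt_card (s := {a, b}) (t := Finset.univ)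
    (Finset.card_le_two.trans_lt (by rw [Finset.card_univ]; omega))
  exact ⟨c, by simpa using hc.2⟩

theorem TwoVertexConnected.bridgelessOn_univ (h : TwoVertexConnected V E) :
    BridgelessOn E Set.univ := by
  have singleton_of_cut : ∀ a b X, IsBridgeCut E Set.univ a b X → X ⊆ {a} := by
    intro a b X hX x hx
    by_contra hxa
    have hba : b ≠ a := by rintro rfl; exact hX.right_notMem_cut hX.left_mem_cut
    obtain ⟨c, hc, d, -, he, hcX, hdX⟩ := (h.stronglyConnectedOn_compl a).exists_leaving
      (u := x) (v := b) hxa hba hx hX.right_notMem_cut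
    exact hc (hX.eq_of_leaving c trivial d trivial he hcX hdX).1
  intro a b X hX
  obtain ⟨c, hca, hcb⟩ := exists_ne_ne_of_three_le_card h.1 a b
  exact hcb (singleton_of_cut _ _ _ hX.symm ⟨trivial, fun hc => hca (singleton_of_cut _ _ _ hX hc)⟩)

theorem TwoVertexConnected.two_mul_card_le (h : TwoVertexConnected V E) :
    2 * Fintype.card V ≤ E.card := by
  classical
  rw [Finset.card_eq_sum_card_fiberwise (f := Prod.fst) (t := Finset.univ) (by simp), mul_comm,
    ← smul_eq_mul, ← Finset.card_univ]
  refine Finset.card_nsmul_le_sum _ _ _ fun v _ => ?_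
  obtain ⟨u, huv, -⟩ := exists_ne_ne_of_three_le_card h.1 v v
  obtain ⟨c, -, w, -, he, hc, hwv⟩ :=
    h.stronglyConnectedOn_univ.exists_leaving (u := v) (v := u) (X := {v}) trivial trivial rfl huv
  obtain ⟨u', hu'v, hu'w⟩ := exists_ne_ne_of_three_le_card h.1 v w
  obtain ⟨c', -, w', hw', he', hc', -⟩ :=
    (h.stronglyConnectedOn_compl w).exists_leaving (u := v) (v := u') (X := {v}) (Ne.symm hwv)
      hu'w rfl hu'v
  rw [Set.mem_singleton_iff.1 hc] at he
  rw [Set.mem_singleton_iff.1 hc'] at he'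
  exact Finset.one_lt_card.2 ⟨(v, w), by simpa using he, (v, w'), by simpa using he',
    fun hww' => hw' (Prod.mk.inj hww').2.symm⟩

end TwoVertexConnected

/-- the approximation guarantee `(2 + a_t/2)` for the M2VTCS problem. -/
theorem stmt11 {V : Type*} [Fintype V] (E E2v : Finset (V × V)) (n at_ : ℕ)
    (hn : n = Fintype.card V)
    (hloop : ∀ u : V, (u, u) ∉ E)
    (hG : TwoVertexTwinlessConnected V E)
    (hsub : E2v ⊆ E) (h2vc : TwoVertexConnected V E2v)
    (hcard : E2v.card ≤ 4 * n)
    (hat : at_ = Set.ncard {x : V | ¬ TwinlessSConnOn E2v ({x}ᶜ : Set V)}) :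
    ∃ E2t ⊆ E, TwoVertexTwinlessConnected V E2t ∧
      ∀ Eopt ⊆ E, TwoVertexTwinlessConnected V Eopt →
        (∀ F ⊆ E, TwoVertexTwinlessConnected V F → Eopt.card ≤ F.card) →
        (E2t.card : ℝ) ≤ (2 + (at_ : ℝ) / 2) * Eopt.card := by
  classical
  have hres : ∀ x, ∃ A ⊆ E, A.card ≤ Fintype.card V ∧ TwinlessSConnOn (E2v ∪ A) {x}ᶜ := by
    intro x
    have hconn := h2vc.stronglyConnectedOn_compl x
    obtain ⟨A, hAE, hcardA, hA⟩ := hconn.exists_bridgelessOn_union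
      (TwinlessSConnOn.bridgelessOn (E := E) (by simpa using hG.2 {x} (by simp)))
    exact ⟨A, hAE, hcardA, (hconn.mono Finset.subset_union_left).twinlessSConnOn hA
      fun u hu => hloop u (Finset.union_subset hsub hAE hu)⟩
  choose A hAE hcardA hA using hres
  set T : Finset V := {x | ¬ TwinlessSConnOn E2v ({x}ᶜ : Set V)} with hT
  have hTcard : T.card = at_ := by
    rw [hat, ← Set.ncard_coe_finset]
    simp [hT]
  refine ⟨E2v ∪ T.biUnion A, Finset.union_subset hsub (Finset.biUnion_subset.2 fun x _ => hAE x),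
    ⟨h2vc.1, fun U hU => ?_⟩, fun Eopt _ hopt _ => ?_⟩
  · rcases U.eq_empty_or_nonempty with rfl | hne
    · have h := h2vc.stronglyConnectedOn_univ.twinlessSConnOn h2vc.bridgelessOn_univ
        fun u hu => hloop u (hsub hu)
      simpa using h.mono Finset.subset_union_left
    · obtain ⟨x, rfl⟩ := Finset.card_eq_one.1 (hU.antisymm hne.card_pos)
      rw [Finset.coe_singleton]
      by_cases hx : TwinlessSConnOn E2v ({x}ᶜ : Set V)
      · exact hx.mono Finset.subset_union_left
      · exact (hA x).mono (Finset.union_subset_union_right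
          (Finset.subset_biUnion_of_mem A (by simpa [hT] using hx)))
  · have hlow : 2 * n ≤ Eopt.card := hn ▸ hopt.twoVertexConnected.two_mul_card_le
    have hup : (E2v ∪ T.biUnion A).card ≤ 4 * n + at_ * n :=
      (Finset.card_union_le _ _).trans (Nat.add_le_add hcard
        (hTcard ▸ hn ▸ Finset.card_biUnion_le_card_mul T A _ fun x _ => hcardA x))
    have hlow' : (2 * n : ℝ) ≤ Eopt.card := by exact_mod_cast hlow
    calc ((E2v ∪ T.biUnion A).card : ℝ) ≤ 4 * n + at_ * n := by exact_mod_cast hup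
      _ = (2 + (at_ : ℝ) / 2) * (2 * n) := by ring
      _ ≤ (2 + (at_ : ℝ) / 2) * Eopt.card := by gcongr
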